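/- Normal form of a primitive positive 3-form: let φ be a 3-form on ℝ⁶ with ω ∧ φ = 0, λ_φ < 0, and ω(x, J_φ x) > 0 for all x ≠ 0, and set M := ((−λ_φ)/4)^{1/4} > 0. Then there exists an invertible linear map P : ℝ⁶ → ℝ⁶ such that ω(Px, Py) = ω(x, y) for all x, y ∈ ℝ⁶ and φ(Px, Py, Pz) = M·φ₀(x, y, z) for all x, y, z ∈ ℝ⁶. -/

import Mathlib

noncomputable section

/-- The underlying vector space `V = ℝ⁶`. -/
abbrev V6 : Type := Fin 6 → ℝ

/-- The standard basis of `ℝ⁶`. -/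
def e6 (i : Fin 6) : V6 := fun j => if j = i then (1 : ℝ) else 0

/-- The standard symplectic form `ω = e¹∧e² + e³∧e⁴ + e⁵∧e⁶`. -/
def ω6 (x y : V6) : ℝ :=
  x 0 * y 1 - x 1 * y 0 + x 2 * y 3 - x 3 * y 2 + x 4 * y 5 - x 5 * y 4

/-- Wedge product of a 2-form and a 3-form (standard convention `1/(2!·3!)`). -/
def wedge23 (a : V6 → V6 → ℝ) (b : V6 → V6 → V6 → ℝ) (v : Fin 5 → V6) : ℝ :=
  (1 / 12 : ℝ) * ∑ σ : Equiv.Perm (Fin 5),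
    ((Equiv.Perm.sign σ : ℤ) : ℝ) *
      (a (v (σ 0)) (v (σ 1)) * b (v (σ 2)) (v (σ 3)) (v (σ 4)))

/-- Hitchin's map `K_φ`, characterized by `ι_{K_φ v} vol = -(ι_v φ) ∧ φ` (here written out
in components using the volume form `vol = e¹∧⋯∧e⁶`). -/
def Kmap (φ : V6 → V6 → V6 → ℝ) (x : V6) : V6 := fun i =>
  (-1 : ℝ) ^ (i : ℕ) *
    (-(wedge23 (fun y z => φ x y z) φ (fun j => e6 (i.succAbove j))))

/-- Hitchin's invariant `λ_φ = (1/6)·tr(K_φ²)`. -/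
def lamH (φ : V6 → V6 → V6 → ℝ) : ℝ :=
  (1 / 6 : ℝ) * ∑ i : Fin 6, Kmap φ (Kmap φ (e6 i)) i

/-- Hitchin's almost complex structure `J_φ = K_φ / √(-λ_φ)`. -/
def Jmap (φ : V6 → V6 → V6 → ℝ) (x : V6) : V6 :=
  (Real.sqrt (-(lamH φ)))⁻¹ • Kmap φ x

/-- A 3-form, viewed as a trilinear function of vectors. -/
def ap3 (φ : AlternatingMap ℝ V6 ℝ (Fin 3)) : V6 → V6 → V6 → ℝ :=
  fun x y z => φ ![x, y, z]


/-- The elementary 3-form `e^a ∧ e^b ∧ e^c`, as a trilinear function. -/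
def elem3 (a b c : Fin 6) (x y z : V6) : ℝ :=
  Matrix.det !![x a, x b, x c; y a, y b, y c; z a, z b, z c]

/-- The model 3-form `φ₀ = e¹∧e³∧e⁵ − e¹∧e⁴∧e⁶ − e²∧e⁴∧e⁵ − e²∧e³∧e⁶`. -/
def phi0 (x y z : V6) : ℝ :=
  elem3 0 2 4 x y z - elem3 0 3 5 x y z - elem3 1 3 4 x y z - elem3 1 2 5 x y z

/-- The signed sum of `G (v ∘ σ)` over all permutations `σ`. -/
def signedSum {α : Type*} {n : ℕ} (G : (Fin n → α) → ℝ) (v : Fin n → α) : ℝ :=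
  ∑ σ : Equiv.Perm (Fin n), ((Equiv.Perm.sign σ : ℤ) : ℝ) * G (v ∘ σ)

theorem signedSum_succ {α : Type*} {n : ℕ} (G : (Fin (n + 1) → α) → ℝ) (v : Fin (n + 1) → α) :
    signedSum G v = ∑ p : Fin (n + 1), (if p = 0 then 1 else -1) *
      signedSum (fun w => G (Fin.cons (v p) w)) (fun i => v (Equiv.swap 0 p i.succ)) := by
  unfold signedSum
  rw [← Equiv.sum_comp Equiv.Perm.decomposeFin.symm, Fintype.sum_prod_type]
  refine Finset.sum_congr rfl fun p _ => ?_
  rw [Finset.mul_sum]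
  refine Finset.sum_congr rfl fun e _ => ?_
  have h : v ∘ (Equiv.Perm.decomposeFin.symm (p, e)) =
      Fin.cons (v p) ((fun i => v (Equiv.swap 0 p i.succ)) ∘ e) := by
    funext i
    refine Fin.cases ?_ (fun j => ?_) i
    · simp
    · simp [Equiv.Perm.decomposeFin_symm_apply_succ]
  rw [h, Equiv.Perm.decomposeFin.symm_sign]
  split_ifs <;> simp

theorem signedSum_two {α : Type*} (G : (Fin 2 → α) → ℝ) (a b : α) :
    signedSum G ![a, b] = G ![a, b] - G ![b, a] := by
  have h (w : α) (v : Fin 1 → α) : (Fin.cons w v : Fin 2 → α) = ![w, v 0] := by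
    funext i; fin_cases i <;> rfl
  rw [signedSum_succ, Fin.sum_univ_two]
  simp [signedSum, h, Equiv.swap_apply_def]
  ring

theorem signedSum_three {α : Type*} (G : (Fin 3 → α) → ℝ) (a b c : α) :
    signedSum G ![a, b, c] = signedSum (fun w => G (Fin.cons a w)) ![b, c]
      - signedSum (fun w => G (Fin.cons b w)) ![a, c]
      - signedSum (fun w => G (Fin.cons c w)) ![b, a] := by
  rw [signedSum_succ, Fin.sum_univ_three]
  have h (p : Fin 3) : (fun i : Fin 2 => ![a, b, c] (Equiv.swap 0 p i.succ)) =
      ![![a, b, c] (Equiv.swap 0 p 1), ![a, b, c] (Equiv.swap 0 p 2)] := by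
    funext i; fin_cases i <;> rfl
  simp only [h]
  simp [Equiv.swap_apply_def]
  ring

theorem signedSum_four {α : Type*} (G : (Fin 4 → α) → ℝ) (a b c d : α) :
    signedSum G ![a, b, c, d] = signedSum (fun w => G (Fin.cons a w)) ![b, c, d]
      - signedSum (fun w => G (Fin.cons b w)) ![a, c, d]
      - signedSum (fun w => G (Fin.cons c w)) ![b, a, d]
      - signedSum (fun w => G (Fin.cons d w)) ![b, c, a] := by
  rw [signedSum_succ, Fin.sum_univ_four]
  have h (p : Fin 4) : (fun i : Fin 3 => ![a, b, c, d] (Equiv.swap 0 p i.succ)) =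
      ![![a, b, c, d] (Equiv.swap 0 p 1), ![a, b, c, d] (Equiv.swap 0 p 2),
        ![a, b, c, d] (Equiv.swap 0 p 3)] := by
    funext i; fin_cases i <;> rfl
  simp only [h]
  simp [Equiv.swap_apply_def]
  ring

theorem signedSum_five {α : Type*} (G : (Fin 5 → α) → ℝ) (a b c d e : α) :
    signedSum G ![a, b, c, d, e] = signedSum (fun w => G (Fin.cons a w)) ![b, c, d, e]
      - signedSum (fun w => G (Fin.cons b w)) ![a, c, d, e]
      - signedSum (fun w => G (Fin.cons c w)) ![b, a, d, e]
      - signedSum (fun w => G (Fin.cons d w)) ![b, c, a, e]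
      - signedSum (fun w => G (Fin.cons e w)) ![b, c, d, a] := by
  rw [signedSum_succ, Fin.sum_univ_five]
  have h (p : Fin 5) : (fun i : Fin 4 => ![a, b, c, d, e] (Equiv.swap 0 p i.succ)) =
      ![![a, b, c, d, e] (Equiv.swap 0 p 1), ![a, b, c, d, e] (Equiv.swap 0 p 2),
        ![a, b, c, d, e] (Equiv.swap 0 p 3), ![a, b, c, d, e] (Equiv.swap 0 p 4)] := by
    funext i; fin_cases i <;> rfl
  simp only [h]
  simp [Equiv.swap_apply_def]
  ring

theorem wedge23_eq {a : V6 → V6 → ℝ} {b : V6 → V6 → V6 → ℝ} (ha : ∀ x y, a y x = -a x y)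
    (hb : ∀ x y z, b y x z = -b x y z) (hb' : ∀ x y z, b x z y = -b x y z)
    (v₀ v₁ v₂ v₃ v₄ : V6) :
    wedge23 a b ![v₀, v₁, v₂, v₃, v₄] =
      a v₀ v₁ * b v₂ v₃ v₄ - a v₀ v₂ * b v₁ v₃ v₄ + a v₀ v₃ * b v₁ v₂ v₄
      - a v₀ v₄ * b v₁ v₂ v₃ + a v₁ v₂ * b v₀ v₃ v₄ - a v₁ v₃ * b v₀ v₂ v₄
      + a v₁ v₄ * b v₀ v₂ v₃ + a v₂ v₃ * b v₀ v₁ v₄ - a v₂ v₄ * b v₀ v₁ v₃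
      + a v₃ v₄ * b v₀ v₁ v₂ := by
  have h : wedge23 a b ![v₀, v₁, v₂, v₃, v₄] = 1 / 12 *
      signedSum (fun w => a (w 0) (w 1) * b (w 2) (w 3) (w 4)) ![v₀, v₁, v₂, v₃, v₄] := rfl
  rw [h]
  simp only [signedSum_five, signedSum_four, signedSum_three, signedSum_two]
  have c1 {n : ℕ} (x : V6) (w : Fin (n + 1) → V6) : (Fin.cons x w : Fin (n + 2) → V6) 1 = w 0 := rfl
  have c2 {n : ℕ} (x : V6) (w : Fin (n + 2) → V6) : (Fin.cons x w : Fin (n + 3) → V6) 2 = w 1 := rfl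
  have c3 {n : ℕ} (x : V6) (w : Fin (n + 3) → V6) : (Fin.cons x w : Fin (n + 4) → V6) 3 = w 2 := rfl
  have c4 {n : ℕ} (x : V6) (w : Fin (n + 4) → V6) : (Fin.cons x w : Fin (n + 5) → V6) 4 = w 3 := rfl
  simp only [Fin.cons_zero, c1, c2, c3, c4, Matrix.cons_val_zero, Matrix.cons_val_one]
  simp only [ha v₀ v₁, ha v₀ v₂, ha v₀ v₃, ha v₀ v₄, ha v₁ v₂, ha v₁ v₃, ha v₁ v₄, ha v₂ v₃,
    ha v₂ v₄, ha v₃ v₄, hb v₀ v₁, hb v₀ v₂, hb v₀ v₃, hb v₀ v₄, hb v₁ v₂, hb v₁ v₃, hb v₁ v₄,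
    hb v₂ v₃, hb v₂ v₄, hb v₃ v₄, hb' _ v₀ v₂, hb' _ v₀ v₃, hb' _ v₀ v₄,
    hb' _ v₁ v₂, hb' _ v₁ v₃, hb' _ v₁ v₄, hb' _ v₂ v₃, hb' _ v₂ v₄, hb' _ v₃ v₄]
  ring

theorem ap3_swap₁₂ (φ : AlternatingMap ℝ V6 ℝ (Fin 3)) (x y z : V6) :
    ap3 φ y x z = -ap3 φ x y z := by
  have h := φ.map_swap ![x, y, z] (i := 0) (j := 1) (by decide)
  have e : ![x, y, z] ∘ Equiv.swap (0 : Fin 3) 1 = ![y, x, z] := by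
    funext i; fin_cases i <;> rfl
  rwa [e] at h

theorem ap3_swap₂₃ (φ : AlternatingMap ℝ V6 ℝ (Fin 3)) (x y z : V6) :
    ap3 φ x z y = -ap3 φ x y z := by
  have h := φ.map_swap ![x, y, z] (i := 1) (j := 2) (by decide)
  have e : ![x, y, z] ∘ Equiv.swap (1 : Fin 3) 2 = ![x, z, y] := by
    funext i; fin_cases i <;> rfl
  rwa [e] at h

theorem ap3_self_left (φ : AlternatingMap ℝ V6 ℝ (Fin 3)) (x z : V6) : ap3 φ x x z = 0 :=
  φ.map_eq_zero_of_eq ![x, x, z] (i := 0) (j := 1) rfl (by decide)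

theorem ap3_self_right (φ : AlternatingMap ℝ V6 ℝ (Fin 3)) (x z : V6) : ap3 φ z x x = 0 :=
  φ.map_eq_zero_of_eq ![z, x, x] (i := 1) (j := 2) rfl (by decide)

theorem ap3_self_outer (φ : AlternatingMap ℝ V6 ℝ (Fin 3)) (x z : V6) : ap3 φ x z x = 0 :=
  φ.map_eq_zero_of_eq ![x, z, x] (i := 0) (j := 2) rfl (by decide)

theorem ap3_sum_left (φ : AlternatingMap ℝ V6 ℝ (Fin 3)) {ι : Type*} (s : Finset ι) (c : ι → ℝ)
    (f : ι → V6) (y z : V6) :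
    ap3 φ (∑ i ∈ s, c i • f i) y z = ∑ i ∈ s, c i * ap3 φ (f i) y z := by
  change φ.curryLeft (∑ i ∈ s, c i • f i) ![y, z] = ∑ i ∈ s, c i * φ.curryLeft (f i) ![y, z]
  rw [map_sum]
  induction s using Finset.cons_induction with
  | empty => simp
  | cons a s ha ih => rw [Finset.sum_cons, Finset.sum_cons, AlternatingMap.add_apply, ih]; simp

theorem ap3_sum_mid (φ : AlternatingMap ℝ V6 ℝ (Fin 3)) {ι : Type*} (s : Finset ι) (c : ι → ℝ)
    (f : ι → V6) (x z : V6) :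
    ap3 φ x (∑ i ∈ s, c i • f i) z = ∑ i ∈ s, c i * ap3 φ x (f i) z := by
  rw [ap3_swap₁₂, ap3_sum_left, ← Finset.sum_neg_distrib]
  exact Finset.sum_congr rfl fun i _ => by rw [ap3_swap₁₂ φ x]; ring

theorem ap3_sum_right (φ : AlternatingMap ℝ V6 ℝ (Fin 3)) {ι : Type*} (s : Finset ι) (c : ι → ℝ)
    (f : ι → V6) (x y : V6) :
    ap3 φ x y (∑ i ∈ s, c i • f i) = ∑ i ∈ s, c i * ap3 φ x y (f i) := by
  rw [ap3_swap₂₃, ap3_sum_mid, ← Finset.sum_neg_distrib]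
  exact Finset.sum_congr rfl fun i _ => by rw [ap3_swap₂₃ φ x y]; ring

theorem eq_sum_smul_e6 (x : V6) : x = ∑ i, x i • e6 i := by
  funext j
  simp [e6, Finset.sum_apply]

theorem ap3_eq_sum_elem3 (φ : AlternatingMap ℝ V6 ℝ (Fin 3)) (x y z : V6) :
    ap3 φ x y z =
      ap3 φ (e6 0) (e6 1) (e6 2) * elem3 0 1 2 x y z
      + ap3 φ (e6 0) (e6 1) (e6 3) * elem3 0 1 3 x y z
      + ap3 φ (e6 0) (e6 1) (e6 4) * elem3 0 1 4 x y z
      + ap3 φ (e6 0) (e6 1) (e6 5) * elem3 0 1 5 x y z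
      + ap3 φ (e6 0) (e6 2) (e6 3) * elem3 0 2 3 x y z
      + ap3 φ (e6 0) (e6 2) (e6 4) * elem3 0 2 4 x y z
      + ap3 φ (e6 0) (e6 2) (e6 5) * elem3 0 2 5 x y z
      + ap3 φ (e6 0) (e6 3) (e6 4) * elem3 0 3 4 x y z
      + ap3 φ (e6 0) (e6 3) (e6 5) * elem3 0 3 5 x y z
      + ap3 φ (e6 0) (e6 4) (e6 5) * elem3 0 4 5 x y z
      + ap3 φ (e6 1) (e6 2) (e6 3) * elem3 1 2 3 x y z
      + ap3 φ (e6 1) (e6 2) (e6 4) * elem3 1 2 4 x y z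
      + ap3 φ (e6 1) (e6 2) (e6 5) * elem3 1 2 5 x y z
      + ap3 φ (e6 1) (e6 3) (e6 4) * elem3 1 3 4 x y z
      + ap3 φ (e6 1) (e6 3) (e6 5) * elem3 1 3 5 x y z
      + ap3 φ (e6 1) (e6 4) (e6 5) * elem3 1 4 5 x y z
      + ap3 φ (e6 2) (e6 3) (e6 4) * elem3 2 3 4 x y z
      + ap3 φ (e6 2) (e6 3) (e6 5) * elem3 2 3 5 x y z
      + ap3 φ (e6 2) (e6 4) (e6 5) * elem3 2 4 5 x y z
      + ap3 φ (e6 3) (e6 4) (e6 5) * elem3 3 4 5 x y z := by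
  conv_lhs => rw [eq_sum_smul_e6 x, eq_sum_smul_e6 y, eq_sum_smul_e6 z]
  simp only [ap3_sum_left, ap3_sum_mid, ap3_sum_right]
  have h₁ (i j : Fin 6) := ap3_swap₁₂ φ (e6 i) (e6 j)
  have h₂ (i j k : Fin 6) := ap3_swap₂₃ φ (e6 k) (e6 i) (e6 j)
  simp only [Fin.sum_univ_six, ap3_self_left, ap3_self_right, ap3_self_outer,
    h₁ 0 1, h₁ 0 2, h₁ 0 3, h₁ 0 4, h₁ 0 5, h₁ 1 2, h₁ 1 3, h₁ 1 4, h₁ 1 5, h₁ 2 3, h₁ 2 4,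
    h₁ 2 5, h₁ 3 4, h₁ 3 5, h₁ 4 5, h₂ 0 2, h₂ 0 3, h₂ 0 4, h₂ 0 5, h₂ 1 2, h₂ 1 3,
    h₂ 1 4, h₂ 1 5, h₂ 2 3, h₂ 2 4, h₂ 2 5, h₂ 3 4, h₂ 3 5, h₂ 4 5]
  simp only [elem3, Matrix.det_fin_three, Matrix.of_apply, Matrix.cons_val]
  ring

/-- The general `ω6`-primitive 3-form. -/
def primForm (p : Fin 14 → ℝ) (x y z : V6) : ℝ :=
  p 0 * elem3 0 2 4 x y z + p 1 * elem3 0 2 5 x y z + p 2 * elem3 0 3 4 x y z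
  + p 3 * elem3 0 3 5 x y z + p 4 * elem3 1 2 4 x y z + p 5 * elem3 1 2 5 x y z
  + p 6 * elem3 1 3 4 x y z + p 7 * elem3 1 3 5 x y z
  + p 8 * (elem3 0 4 5 x y z - elem3 0 2 3 x y z) + p 9 * (elem3 1 4 5 x y z - elem3 1 2 3 x y z)
  + p 10 * (elem3 2 4 5 x y z - elem3 0 1 2 x y z)
  + p 11 * (elem3 3 4 5 x y z - elem3 0 1 3 x y z)
  + p 12 * (elem3 2 3 4 x y z - elem3 0 1 4 x y z)
  + p 13 * (elem3 2 3 5 x y z - elem3 0 1 5 x y z)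

theorem exists_ap3_eq_primForm (φ : AlternatingMap ℝ V6 ℝ (Fin 3))
    (hprim : ∀ v : Fin 5 → V6, wedge23 ω6 (ap3 φ) v = 0) : ∃ p, ap3 φ = primForm p := by
  have w (x₀ x₁ x₂ x₃ x₄ : V6) := hprim ![x₀, x₁, x₂, x₃, x₄]
  simp only [wedge23_eq (a := ω6) (fun x y => by unfold ω6; ring) (ap3_swap₁₂ φ) (ap3_swap₂₃ φ)]
    at w
  have w₀ := w (e6 1) (e6 2) (e6 3) (e6 4) (e6 5)
  have w₁ := w (e6 0) (e6 2) (e6 3) (e6 4) (e6 5)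
  have w₂ := w (e6 0) (e6 1) (e6 3) (e6 4) (e6 5)
  have w₃ := w (e6 0) (e6 1) (e6 2) (e6 4) (e6 5)
  have w₄ := w (e6 0) (e6 1) (e6 2) (e6 3) (e6 5)
  have w₅ := w (e6 0) (e6 1) (e6 2) (e6 3) (e6 4)
  simp [ω6, e6] at w₀ w₁ w₂ w₃ w₄ w₅
  let C (i j k : Fin 6) : ℝ := ap3 φ (e6 i) (e6 j) (e6 k)
  refine ⟨![C 0 2 4, C 0 2 5, C 0 3 4, C 0 3 5, C 1 2 4, C 1 2 5, C 1 3 4, C 1 3 5, C 0 4 5,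
    C 1 4 5, C 2 4 5, C 3 4 5, C 2 3 4, C 2 3 5], ?_⟩
  funext x y z
  rw [ap3_eq_sum_elem3]
  simp only [primForm, Matrix.cons_val, C]
  linear_combination w₀ * elem3 1 2 3 x y z + w₁ * elem3 0 2 3 x y z + w₂ * elem3 0 1 3 x y z
    + w₃ * elem3 0 1 2 x y z + w₄ * elem3 0 1 5 x y z + w₅ * elem3 0 1 4 x y z
/-- The matrix of Hitchin's map of `primForm p`. -/
def hitchinMatrix (p : Fin 14 → ℝ) : Matrix (Fin 6) (Fin 6) ℝ :=
  !![p 0 * p 7 - p 1 * p 6 - p 2 * p 5 + p 3 * p 4 + 2 * p 8 * p 9,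
       2 * p 4 * p 7 - 2 * p 5 * p 6 + 2 * p 9 ^ 2,
       2 * p 4 * p 13 - 2 * p 5 * p 12 + 2 * p 9 * p 10,
       2 * p 6 * p 13 - 2 * p 7 * p 12 + 2 * p 9 * p 11,
       -2 * p 4 * p 11 + 2 * p 6 * p 10 - 2 * p 9 * p 12,
       -2 * p 5 * p 11 + 2 * p 7 * p 10 - 2 * p 9 * p 13;
     -2 * p 0 * p 3 + 2 * p 1 * p 2 - 2 * p 8 ^ 2,
       -p 0 * p 7 + p 1 * p 6 + p 2 * p 5 - p 3 * p 4 - 2 * p 8 * p 9,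
       -2 * p 0 * p 13 + 2 * p 1 * p 12 - 2 * p 8 * p 10,
       -2 * p 2 * p 13 + 2 * p 3 * p 12 - 2 * p 8 * p 11,
       2 * p 0 * p 11 - 2 * p 2 * p 10 + 2 * p 8 * p 12,
       2 * p 1 * p 11 - 2 * p 3 * p 10 + 2 * p 8 * p 13;
     2 * p 2 * p 13 - 2 * p 3 * p 12 + 2 * p 8 * p 11,
       2 * p 6 * p 13 - 2 * p 7 * p 12 + 2 * p 9 * p 11,
       p 0 * p 7 - p 1 * p 6 + p 2 * p 5 - p 3 * p 4 + 2 * p 10 * p 11,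
       2 * p 2 * p 7 - 2 * p 3 * p 6 + 2 * p 11 ^ 2,
       2 * p 2 * p 9 - 2 * p 6 * p 8 + 2 * p 11 * p 12,
       2 * p 3 * p 9 - 2 * p 7 * p 8 + 2 * p 11 * p 13;
     -2 * p 0 * p 13 + 2 * p 1 * p 12 - 2 * p 8 * p 10,
       -2 * p 4 * p 13 + 2 * p 5 * p 12 - 2 * p 9 * p 10,
       -2 * p 0 * p 5 + 2 * p 1 * p 4 - 2 * p 10 ^ 2,
       -p 0 * p 7 + p 1 * p 6 - p 2 * p 5 + p 3 * p 4 - 2 * p 10 * p 11,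
       -2 * p 0 * p 9 + 2 * p 4 * p 8 - 2 * p 10 * p 12,
       -2 * p 1 * p 9 + 2 * p 5 * p 8 - 2 * p 10 * p 13;
     -2 * p 1 * p 11 + 2 * p 3 * p 10 - 2 * p 8 * p 13,
       -2 * p 5 * p 11 + 2 * p 7 * p 10 - 2 * p 9 * p 13,
       2 * p 1 * p 9 - 2 * p 5 * p 8 + 2 * p 10 * p 13,
       2 * p 3 * p 9 - 2 * p 7 * p 8 + 2 * p 11 * p 13,
       p 0 * p 7 + p 1 * p 6 - p 2 * p 5 - p 3 * p 4 + 2 * p 12 * p 13,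
       2 * p 1 * p 7 - 2 * p 3 * p 5 + 2 * p 13 ^ 2;
     2 * p 0 * p 11 - 2 * p 2 * p 10 + 2 * p 8 * p 12,
       2 * p 4 * p 11 - 2 * p 6 * p 10 + 2 * p 9 * p 12,
       -2 * p 0 * p 9 + 2 * p 4 * p 8 - 2 * p 10 * p 12,
       -2 * p 2 * p 9 + 2 * p 6 * p 8 - 2 * p 11 * p 12,
       -2 * p 0 * p 6 + 2 * p 2 * p 4 - 2 * p 12 ^ 2,
       -p 0 * p 7 - p 1 * p 6 + p 2 * p 5 + p 3 * p 4 - 2 * p 12 * p 13]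

/-- The matrix of the 2-form `primForm p x`. -/
def contraction (p : Fin 14 → ℝ) (x : V6) : Matrix (Fin 6) (Fin 6) ℝ :=
  !![0,
       -p 10 * x 2 - p 11 * x 3 - p 12 * x 4 - p 13 * x 5,
       p 10 * x 1 - p 8 * x 3 + p 0 * x 4 + p 1 * x 5,
       p 11 * x 1 + p 8 * x 2 + p 2 * x 4 + p 3 * x 5,
       p 12 * x 1 - p 0 * x 2 - p 2 * x 3 + p 8 * x 5,
       p 13 * x 1 - p 1 * x 2 - p 3 * x 3 - p 8 * x 4;
     p 10 * x 2 + p 11 * x 3 + p 12 * x 4 + p 13 * x 5,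
       0,
       -p 10 * x 0 - p 9 * x 3 + p 4 * x 4 + p 5 * x 5,
       -p 11 * x 0 + p 9 * x 2 + p 6 * x 4 + p 7 * x 5,
       -p 12 * x 0 - p 4 * x 2 - p 6 * x 3 + p 9 * x 5,
       -p 13 * x 0 - p 5 * x 2 - p 7 * x 3 - p 9 * x 4;
     -p 10 * x 1 + p 8 * x 3 - p 0 * x 4 - p 1 * x 5,
       p 10 * x 0 + p 9 * x 3 - p 4 * x 4 - p 5 * x 5,
       0,
       -p 8 * x 0 - p 9 * x 1 + p 12 * x 4 + p 13 * x 5,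
       p 0 * x 0 + p 4 * x 1 - p 12 * x 3 + p 10 * x 5,
       p 1 * x 0 + p 5 * x 1 - p 13 * x 3 - p 10 * x 4;
     -p 11 * x 1 - p 8 * x 2 - p 2 * x 4 - p 3 * x 5,
       p 11 * x 0 - p 9 * x 2 - p 6 * x 4 - p 7 * x 5,
       p 8 * x 0 + p 9 * x 1 - p 12 * x 4 - p 13 * x 5,
       0,
       p 2 * x 0 + p 6 * x 1 + p 12 * x 2 + p 11 * x 5,
       p 3 * x 0 + p 7 * x 1 + p 13 * x 2 - p 11 * x 4;
     -p 12 * x 1 + p 0 * x 2 + p 2 * x 3 - p 8 * x 5,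
       p 12 * x 0 + p 4 * x 2 + p 6 * x 3 - p 9 * x 5,
       -p 0 * x 0 - p 4 * x 1 + p 12 * x 3 - p 10 * x 5,
       -p 2 * x 0 - p 6 * x 1 - p 12 * x 2 - p 11 * x 5,
       0,
       p 8 * x 0 + p 9 * x 1 + p 10 * x 2 + p 11 * x 3;
     -p 13 * x 1 + p 1 * x 2 + p 3 * x 3 + p 8 * x 4,
       p 13 * x 0 + p 5 * x 2 + p 7 * x 3 + p 9 * x 4,
       -p 1 * x 0 - p 5 * x 1 + p 13 * x 3 + p 10 * x 4,
       -p 3 * x 0 - p 7 * x 1 - p 13 * x 2 + p 11 * x 4,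
       -p 8 * x 0 - p 9 * x 1 - p 10 * x 2 - p 11 * x 3,
       0]

theorem primForm_eq_dotProduct (p : Fin 14 → ℝ) (x y z : V6) :
    primForm p x y z = y ⬝ᵥ (contraction p x).mulVec z := by
  simp only [primForm, elem3, Matrix.det_fin_three, Matrix.of_apply, Matrix.cons_val,
    contraction, dotProduct, Matrix.mulVec, Fin.sum_univ_six]
  ring

theorem primForm_e6_e6 (p : Fin 14 → ℝ) (x : V6) (i j : Fin 6) :
    primForm p x (e6 i) (e6 j) = contraction p x i j := by
  simp [primForm_eq_dotProduct, dotProduct, Matrix.mulVec, e6]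

theorem primForm_swap₁₂ (p : Fin 14 → ℝ) (x y z : V6) :
    primForm p y x z = -primForm p x y z := by
  simp only [primForm, elem3, Matrix.det_fin_three, Matrix.of_apply, Matrix.cons_val]
  ring

theorem primForm_swap₂₃ (p : Fin 14 → ℝ) (x y z : V6) :
    primForm p x z y = -primForm p x y z := by
  simp only [primForm, elem3, Matrix.det_fin_three, Matrix.of_apply, Matrix.cons_val]
  ring

theorem Kmap_primForm (p : Fin 14 → ℝ) (x : V6) :
    Kmap (primForm p) x = (hitchinMatrix p).mulVec x := by
  have h (v : Fin 5 → V6) : v = ![v 0, v 1, v 2, v 3, v 4] := by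
    funext i; fin_cases i <;> rfl
  have e (v : Fin 5 → V6) := wedge23_eq (a := fun y z => primForm p x y z)
    (primForm_swap₂₃ p x) (primForm_swap₁₂ p) (primForm_swap₂₃ p) (v 0) (v 1) (v 2) (v 3) (v 4)
  simp only [← h] at e
  have s (i : Fin 6) (j : Fin 5) : i.succAbove j =
      ![![1, 2, 3, 4, 5], ![0, 2, 3, 4, 5], ![0, 1, 3, 4, 5], ![0, 1, 2, 4, 5],
        ![0, 1, 2, 3, 5], ![0, 1, 2, 3, 4]] i j := by
    fin_cases i <;> fin_cases j <;> rfl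
  have E (i j : Fin 6) : e6 i j = if j = i then 1 else 0 := rfl
  funext i
  simp only [Kmap, e, s, primForm_e6_e6]
  fin_cases i <;>
  · simp [contraction, Matrix.mulVec, dotProduct, Fin.sum_univ_six, hitchinMatrix, E]
    try ring

theorem ω6_hitchinMatrix (p : Fin 14 → ℝ) (x y : V6) :
    ω6 x ((hitchinMatrix p).mulVec y) = ω6 y ((hitchinMatrix p).mulVec x) := by
  simp only [ω6, Matrix.mulVec, dotProduct, Fin.sum_univ_six, hitchinMatrix,
    Matrix.of_apply, Matrix.cons_val]
  ring

theorem hitchinMatrix_mul_self (p : Fin 14 → ℝ) :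
    hitchinMatrix p * hitchinMatrix p = (hitchinMatrix p * hitchinMatrix p) 0 0 • 1 := by
  ext i j
  fin_cases i <;> fin_cases j <;>
  · simp only [Fin.reduceFinMk, Fin.zero_eta, Fin.mk_one, Fin.isValue, Matrix.smul_apply,
      Matrix.one_apply, Fin.reduceEq, if_true, if_false, smul_eq_mul, Matrix.mul_apply,
      Fin.sum_univ_six, hitchinMatrix, Matrix.of_apply, Matrix.cons_val]
    ring

/-- Hitchin's map can be moved between the last two arguments of `primForm p`. -/
theorem transpose_hitchinMatrix_mul_contraction (p : Fin 14 → ℝ) (x : V6) :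
    (hitchinMatrix p).transpose * contraction p x = contraction p x * hitchinMatrix p := by
  ext i j
  fin_cases i <;> fin_cases j <;>
  · simp only [Fin.reduceFinMk, Fin.zero_eta, Fin.mk_one, Fin.isValue, Matrix.transpose_apply,
      Matrix.mul_apply, Fin.sum_univ_six, hitchinMatrix, contraction, Matrix.of_apply,
      Matrix.cons_val]
    ring

theorem ap3_neg_right (φ : AlternatingMap ℝ V6 ℝ (Fin 3)) (x y z : V6) :
    ap3 φ x y (-z) = -ap3 φ x y z := by
  simpa using ap3_sum_right φ {()} (fun _ => -1) (fun _ => z) x y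

theorem ap3_add_smul_left (φ : AlternatingMap ℝ V6 ℝ (Fin 3)) (c d : ℝ) (x x' y z : V6) :
    ap3 φ (c • x + d • x') y z = c * ap3 φ x y z + d * ap3 φ x' y z := by
  simpa using ap3_sum_left φ Finset.univ ![c, d] ![x, x'] y z

/-- The symplectic form `ω6` as a bilinear map. -/
def symplecticForm : V6 →ₗ[ℝ] V6 →ₗ[ℝ] ℝ :=
  LinearMap.mk₂ ℝ ω6 (by intros; simp [ω6]; ring) (by intros; simp [ω6]; ring)
    (by intros; simp [ω6]; ring) (by intros; simp [ω6]; ring)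

theorem symplecticForm_apply (x y : V6) : symplecticForm x y = ω6 x y := rfl

theorem ω6_swap (x y : V6) : ω6 x y = -ω6 y x := by
  unfold ω6; ring

theorem injective_of_ω6_eq {P : V6 →ₗ[ℝ] V6} (hP : ∀ x y, ω6 (P x) (P y) = ω6 x y) :
    Function.Injective P := by
  rw [← LinearMap.ker_eq_bot, LinearMap.ker_eq_bot']
  intro x hx
  have h (y : V6) : ω6 x y = 0 := by
    rw [← hP, hx, ← symplecticForm_apply, map_zero, LinearMap.zero_apply]
  have h₀ := h (e6 0)
  have h₁ := h (e6 1)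
  have h₂ := h (e6 2)
  have h₃ := h (e6 3)
  have h₄ := h (e6 4)
  have h₅ := h (e6 5)
  simp [ω6, e6] at h₀ h₁ h₂ h₃ h₄ h₅
  funext i
  fin_cases i <;> assumption

section CompatibleStructure

variable {J : V6 →ₗ[ℝ] V6}

theorem ω6_map_left (hsymm : ∀ x y, ω6 x (J y) = ω6 y (J x)) (x y : V6) :
    ω6 (J x) y = -ω6 x (J y) := by
  rw [ω6_swap, hsymm]

theorem ω6_map_map (hJ : ∀ x, J (J x) = -x) (hsymm : ∀ x y, ω6 x (J y) = ω6 y (J x))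
    (x y : V6) : ω6 (J x) (J y) = ω6 x y := by
  rw [hsymm, hJ, ← symplecticForm_apply, map_neg, symplecticForm_apply, ω6_swap, neg_neg]

theorem exists_unit_mem_ker (hpos : ∀ x, x ≠ 0 → 0 < ω6 x (J x)) (L : V6 →ₗ[ℝ] (Fin 4 → ℝ)) :
    ∃ x, L x = 0 ∧ ω6 x (J x) = 1 := by
  obtain ⟨x, hx, hx₀⟩ := (LinearMap.ker L).ne_bot_iff.1
    (LinearMap.ker_ne_bot_of_finrank_lt (by simp))
  have h := hpos x hx₀
  refine ⟨(√(ω6 x (J x)))⁻¹ • x, by simp [LinearMap.mem_ker.1 hx], ?_⟩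
  have h' := Real.mul_self_sqrt h.le
  rw [← symplecticForm_apply, map_smul, map_smul, map_smul, LinearMap.smul_apply,
    symplecticForm_apply, smul_eq_mul, smul_eq_mul]
  have := (Real.sqrt_pos.2 h).ne'
  field_simp
  linarith

/-- A triple `f` such that `f 0, J (f 0), f 1, J (f 1), f 2, J (f 2)` is a symplectic basis. -/
structure IsUnitaryFrame (J : V6 →ₗ[ℝ] V6) (x y z : V6) : Prop where
  xx : ω6 x (J x) = 1
  yy : ω6 y (J y) = 1
  zz : ω6 z (J z) = 1
  xy : ω6 x y = 0
  xz : ω6 x z = 0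
  yz : ω6 y z = 0
  xJy : ω6 x (J y) = 0
  xJz : ω6 x (J z) = 0
  yJz : ω6 y (J z) = 0

theorem exists_isUnitaryFrame (hsymm : ∀ x y, ω6 x (J y) = ω6 y (J x))
    (hpos : ∀ x, x ≠ 0 → 0 < ω6 x (J x)) : ∃ x y z, IsUnitaryFrame J x y z := by
  let L (a b : V6) : V6 →ₗ[ℝ] (Fin 4 → ℝ) := LinearMap.pi
    ![symplecticForm a, symplecticForm (J a), symplecticForm b, symplecticForm (J b)]
  have hL {a b x : V6} (h : L a b x = 0) :
      ω6 a x = 0 ∧ ω6 a (J x) = 0 ∧ ω6 b x = 0 ∧ ω6 b (J x) = 0 := by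
    rw [hsymm a, hsymm b, ω6_swap x, ω6_swap x, neg_eq_zero, neg_eq_zero]
    exact ⟨congrFun h 0, congrFun h 1, congrFun h 2, congrFun h 3⟩
  obtain ⟨x, -, hx⟩ := exists_unit_mem_ker hpos 0
  obtain ⟨y, hy, hy'⟩ := exists_unit_mem_ker hpos (L x x)
  obtain ⟨z, hz, hz'⟩ := exists_unit_mem_ker hpos (L x y)
  obtain ⟨hxy, hxJy, -, -⟩ := hL hy
  obtain ⟨hxz, hxJz, hyz, hyJz⟩ := hL hz
  exact ⟨x, y, z, hx, hy', hz', hxy, hxz, hyz, hxJy, hxJz, hyJz⟩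

theorem IsUnitaryFrame.rotate {x y z : V6} (h : IsUnitaryFrame J x y z) (hJ : ∀ x, J (J x) = -x)
    (hsymm : ∀ x y, ω6 x (J y) = ω6 y (J x)) {c d : ℝ} (hcd : c ^ 2 + d ^ 2 = 1) :
    IsUnitaryFrame J (c • x + d • J x) y z := by
  have hJJ := ω6_map_map hJ hsymm
  have hJl := ω6_map_left hsymm
  have hl (w : V6) : ω6 (c • x + d • J x) w = c * ω6 x w + d * ω6 (J x) w := by
    simp [← symplecticForm_apply]
  refine { h with xx := ?_, xy := ?_, xz := ?_, xJy := ?_, xJz := ?_ }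
  · have hxx : ω6 x x = 0 := by unfold ω6; ring
    have : ω6 x (J (c • x + d • J x)) = c * ω6 x (J x) - d * ω6 x x := by
      simp [← symplecticForm_apply, hJ]; ring
    rw [hl, this, hJJ, ← symplecticForm_apply x (_ + _), map_add, map_smul, map_smul,
      symplecticForm_apply, symplecticForm_apply, h.xx, hxx]
    simp only [smul_eq_mul]
    linear_combination hcd
  · rw [hl, hJl, h.xy, h.xJy]; ring
  · rw [hl, hJl, h.xz, h.xJz]; ring
  · rw [hl, hJJ, h.xy, h.xJy]; ring
  · rw [hl, hJJ, h.xz, h.xJz]; ring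

/-- The linear map sending the standard basis to `x, J x, y, J y, z, J z`. -/
def frameMap (J : V6 →ₗ[ℝ] V6) (x y z : V6) : V6 →ₗ[ℝ] V6 :=
  Fintype.linearCombination ℝ ![x, J x, y, J y, z, J z]

theorem frameMap_e6 (x y z : V6) (i : Fin 6) :
    frameMap J x y z (e6 i) = ![x, J x, y, J y, z, J z] i := by
  simp [frameMap, Fintype.linearCombination_apply, e6]

theorem IsUnitaryFrame.ω6_frameMap {x y z : V6} (h : IsUnitaryFrame J x y z)
    (hJ : ∀ x, J (J x) = -x) (hsymm : ∀ x y, ω6 x (J y) = ω6 y (J x)) (v w : V6) :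
    ω6 (frameMap J x y z v) (frameMap J x y z w) = ω6 v w := by
  have hJJ := ω6_map_map hJ hsymm
  have hJl := ω6_map_left hsymm
  have hs (x : V6) : ω6 x x = 0 := by unfold ω6; ring
  have e : frameMap J x y z v =
      v 0 • x + v 1 • J x + v 2 • y + v 3 • J y + v 4 • z + v 5 • J z := by
    simp [frameMap, Fintype.linearCombination_apply, Fin.sum_univ_six]
  have e' : frameMap J x y z w =
      w 0 • x + w 1 • J x + w 2 • y + w 3 • J y + w 4 • z + w 5 • J z := by
    simp [frameMap, Fintype.linearCombination_apply, Fin.sum_univ_six]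
  rw [e, e', ← symplecticForm_apply]
  simp only [map_add, map_smul, LinearMap.add_apply, LinearMap.smul_apply, symplecticForm_apply,
    hJJ, hJl, hs, h.xx, h.yy, h.zz, h.xy, h.xz, h.yz, h.xJy, h.xJz, h.yJz, ω6_swap y x,
    ω6_swap z x, ω6_swap z y, hsymm y x, hsymm z x, hsymm z y, smul_eq_mul]
  unfold ω6
  ring

theorem ap3_map_left {φ : AlternatingMap ℝ V6 ℝ (Fin 3)}
    (hφ : ∀ x y z, ap3 φ x (J y) z = ap3 φ x y (J z)) (x y z : V6) :
    ap3 φ (J x) y z = ap3 φ x y (J z) := by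
  rw [ap3_swap₁₂, ap3_swap₂₃, ← hφ, ap3_swap₂₃, ap3_swap₁₂]
  ring

theorem ap3_frameMap {φ : AlternatingMap ℝ V6 ℝ (Fin 3)} (hJ : ∀ x, J (J x) = -x)
    (hφ : ∀ x y z, ap3 φ x (J y) z = ap3 φ x y (J z)) {x y z : V6}
    (h₀ : ap3 φ x y (J z) = 0) (u v w : V6) :
    ap3 φ (frameMap J x y z u) (frameMap J x y z v) (frameMap J x y z w) =
      ap3 φ x y z * phi0 u v w := by
  have hφ' := ap3_map_left hφ
  have hl (x z : V6) : ap3 φ x x z = 0 := ap3_self_left φ x z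
  have hr (x z : V6) : ap3 φ x z z = 0 := ap3_self_right φ z x
  have hs (x z : V6) : ap3 φ x z (J z) = 0 := by
    have := hφ x z z
    rw [ap3_swap₂₃] at this
    linarith
  let ψ := φ.compLinearMap (frameMap J x y z)
  have hψ (u v w : V6) : ap3 ψ u v w =
      ap3 φ (frameMap J x y z u) (frameMap J x y z v) (frameMap J x y z w) := by
    change φ _ = φ _
    congr 1
    funext i; fin_cases i <;> rfl
  rw [← hψ, ap3_eq_sum_elem3]
  simp only [hψ, frameMap_e6, Matrix.cons_val, hφ', hφ, hJ, map_neg, ap3_neg_right, h₀, hl, hr, hs]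
  unfold phi0
  ring

theorem exists_frameMap_normal_form {φ : AlternatingMap ℝ V6 ℝ (Fin 3)} (hJ : ∀ x, J (J x) = -x)
    (hsymm : ∀ x y, ω6 x (J y) = ω6 y (J x)) (hpos : ∀ x, x ≠ 0 → 0 < ω6 x (J x))
    (hφ : ∀ x y z, ap3 φ x (J y) z = ap3 φ x y (J z)) :
    ∃ (P : V6 →ₗ[ℝ] V6) (a : ℝ), 0 ≤ a ∧ (∀ x y, ω6 (P x) (P y) = ω6 x y) ∧
      J (P (e6 0)) = P (e6 1) ∧ ∀ x y z, ap3 φ (P x) (P y) (P z) = a * phi0 x y z := by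
  obtain ⟨x, y, z, h⟩ := exists_isUnitaryFrame hsymm hpos
  obtain ⟨c, d, hcd, h₀, hnonneg⟩ : ∃ c d : ℝ, c ^ 2 + d ^ 2 = 1 ∧
      c * ap3 φ x y (J z) - d * ap3 φ x y z = 0 ∧
      0 ≤ c * ap3 φ x y z + d * ap3 φ x y (J z) := by
    generalize ap3 φ x y z = a
    generalize ap3 φ x y (J z) = b
    rcases eq_or_ne (a ^ 2 + b ^ 2) 0 with hab | hab
    · exact ⟨1, 0, by norm_num, by nlinarith, by nlinarith⟩
    · have hab' : 0 < a ^ 2 + b ^ 2 := lt_of_le_of_ne (by positivity) hab.symm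
      have hr := Real.sqrt_pos.2 hab'
      have hr' := Real.sq_sqrt hab'.le
      refine ⟨a / √(a ^ 2 + b ^ 2), b / √(a ^ 2 + b ^ 2), ?_, by ring, ?_⟩
      · rw [div_pow, div_pow, ← add_div, hr', div_self hab]
      · rw [div_mul_eq_mul_div, div_mul_eq_mul_div, ← add_div, ← sq, ← sq]
        positivity
  have hφ' := ap3_map_left hφ
  have h' := h.rotate hJ hsymm hcd
  refine ⟨frameMap J (c • x + d • J x) y z, ap3 φ (c • x + d • J x) y z, ?_,
    h'.ω6_frameMap hJ hsymm, ?_, ap3_frameMap hJ hφ ?_⟩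
  · rwa [ap3_add_smul_left, hφ']
  · simp only [frameMap_e6, Matrix.cons_val]
  · rw [ap3_add_smul_left, hφ', hJ, ap3_neg_right]
    linarith

end CompatibleStructure

theorem lamH_primForm (p : Fin 14 → ℝ) :
    lamH (primForm p) = (hitchinMatrix p * hitchinMatrix p) 0 0 := by
  have h (i : Fin 6) : e6 i = Pi.single i 1 := by
    funext j; simp [e6, Pi.single_apply]
  have h' (i : Fin 6) : Kmap (primForm p) (Kmap (primForm p) (e6 i)) i =
      (hitchinMatrix p * hitchinMatrix p) i i := by
    rw [Kmap_primForm, Kmap_primForm, Matrix.mulVec_mulVec, h, Matrix.mulVec_single_one]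
    rfl
  simp only [lamH, h']
  rw [hitchinMatrix_mul_self]
  simp

theorem hitchinMatrix_mulVec_mulVec (p : Fin 14 → ℝ) (x : V6) :
    (hitchinMatrix p).mulVec ((hitchinMatrix p).mulVec x) = lamH (primForm p) • x := by
  rw [Matrix.mulVec_mulVec, hitchinMatrix_mul_self, Matrix.smul_mulVec, Matrix.one_mulVec,
    lamH_primForm]

theorem primForm_hitchinMatrix (p : Fin 14 → ℝ) (x y z : V6) :
    primForm p x ((hitchinMatrix p).mulVec y) z = primForm p x y ((hitchinMatrix p).mulVec z) := by
  rw [primForm_eq_dotProduct, primForm_eq_dotProduct, Matrix.mulVec_mulVec,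
    ← transpose_hitchinMatrix_mul_contraction, ← Matrix.mulVec_mulVec, Matrix.dotProduct_mulVec y,
    Matrix.vecMul_transpose]

/-- The Gram matrix of `ω6` in the standard basis. -/
def gramMatrix : Matrix (Fin 6) (Fin 6) ℝ :=
  !![0, 1, 0, 0, 0, 0; -1, 0, 0, 0, 0, 0; 0, 0, 0, 1, 0, 0; 0, 0, -1, 0, 0, 0;
     0, 0, 0, 0, 0, 1; 0, 0, 0, 0, -1, 0]

theorem ω6_eq_dotProduct (x y : V6) : ω6 x y = x ⬝ᵥ gramMatrix.mulVec y := by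
  simp only [ω6, gramMatrix, dotProduct, Matrix.mulVec, Fin.sum_univ_six, Matrix.of_apply,
    Matrix.cons_val]
  ring

theorem ω6_e6_e6 (i j : Fin 6) : ω6 (e6 i) (e6 j) = gramMatrix i j := by
  simp [ω6_eq_dotProduct, dotProduct, Matrix.mulVec, e6]

theorem gramMatrix_mul_self : gramMatrix * gramMatrix = -1 := by
  ext i j
  fin_cases i <;> fin_cases j <;>
    simp [gramMatrix, Matrix.mul_apply, Fin.sum_univ_six]

/-- Hitchin's map of a primitive form as a moment map for the symplectic group. -/
theorem ω6_hitchinMatrix_self (p : Fin 14 → ℝ) (x : V6) :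
    ω6 x ((hitchinMatrix p).mulVec x) = -(1 / 2) *
      (gramMatrix * contraction p x * gramMatrix * contraction p x).trace := by
  simp only [ω6, Matrix.trace, Matrix.diag_apply, Matrix.mulVec, dotProduct, Matrix.mul_apply,
    Fin.sum_univ_six, gramMatrix, contraction, hitchinMatrix, Matrix.of_apply, Matrix.cons_val]
  ring

theorem mul_gramMatrix_mul_transpose {A : Matrix (Fin 6) (Fin 6) ℝ}
    (hA : A.transpose * gramMatrix * A = gramMatrix) :
    A * gramMatrix * A.transpose = gramMatrix := by
  have h₁ : -(gramMatrix * A.transpose * gramMatrix) * A = 1 := by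
    rw [Matrix.neg_mul, Matrix.mul_assoc, Matrix.mul_assoc, ← Matrix.mul_assoc A.transpose, hA,
      gramMatrix_mul_self, neg_neg]
  have h₂ := congrArg (· * gramMatrix) (mul_eq_one_comm.1 h₁)
  simpa [Matrix.mul_assoc, gramMatrix_mul_self] using h₂

theorem ω6_hitchinMatrix_of_normal_form {p : Fin 14 → ℝ} {P : V6 →ₗ[ℝ] V6} {a : ℝ}
    (hP : ∀ x y, ω6 (P x) (P y) = ω6 x y)
    (h : ∀ x y z, primForm p (P x) (P y) (P z) = a * phi0 x y z) :
    ω6 (P (e6 0)) ((hitchinMatrix p).mulVec (P (e6 0))) = 2 * a ^ 2 := by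
  set A := LinearMap.toMatrix' P
  have hPA (x : V6) : P x = A.mulVec x := (LinearMap.toMatrix'_mulVec P x).symm
  have pull (B : Matrix (Fin 6) (Fin 6) ℝ) (i j : Fin 6) :
      (A.transpose * B * A) i j = P (e6 i) ⬝ᵥ B.mulVec (P (e6 j)) := by
    have h (i : Fin 6) : e6 i = Pi.single i 1 := by
      funext j; simp [e6, Pi.single_apply]
    rw [hPA, hPA, h, h, Matrix.mulVec_single_one, Matrix.mulVec_single_one, Matrix.mul_assoc]
    rfl
  have hΩ : A * gramMatrix * A.transpose = gramMatrix := by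
    refine mul_gramMatrix_mul_transpose ?_
    ext i j
    rw [pull, ← ω6_eq_dotProduct, hP, ω6_e6_e6]
  have hC : A.transpose * contraction p (P (e6 0)) * A =
      a • contraction ![1, 0, 0, -1, 0, -1, -1, 0, 0, 0, 0, 0, 0, 0] (e6 0) := by
    ext i j
    rw [pull, ← primForm_eq_dotProduct, h, Matrix.smul_apply, ← primForm_e6_e6]
    simp only [primForm, phi0, Matrix.cons_val, smul_eq_mul]
    ring
  set B := contraction p (P (e6 0))
  have htr : (gramMatrix * B * gramMatrix * B).trace =
      (gramMatrix * (A.transpose * B * A) * gramMatrix * (A.transpose * B * A)).trace := by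
    conv_lhs => rw [← hΩ]
    simpa only [Matrix.mul_assoc] using Matrix.trace_mul_comm A
      (gramMatrix * A.transpose * B * A * gramMatrix * A.transpose * B)
  rw [ω6_hitchinMatrix_self, htr, hC]
  simp [Matrix.trace, Fin.sum_univ_six, gramMatrix, contraction, e6]
  ring

/-- Normal form of a primitive positive 3-form: if `ω ∧ φ = 0`, `λ_φ < 0` and
`ω(x, J_φ x) > 0` for all `x ≠ 0`, then with `M := ((−λ_φ)/4)^{1/4} > 0` there is a linear
symplectomorphism `P` with `φ(Px, Py, Pz) = M · φ₀(x,y,z)`. -/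
theorem normal_form_of_primitive_positive (φ : AlternatingMap ℝ V6 ℝ (Fin 3))
    (hprim : ∀ v : Fin 5 → V6, wedge23 ω6 (ap3 φ) v = 0)
    (hlam : lamH (ap3 φ) < 0)
    (hpos : ∀ x : V6, x ≠ 0 → 0 < ω6 x (Jmap (ap3 φ) x)) :
    0 < (-(lamH (ap3 φ)) / 4) ^ ((1 : ℝ) / 4) ∧
    ∃ P : V6 →ₗ[ℝ] V6, Function.Bijective P ∧
      (∀ x y : V6, ω6 (P x) (P y) = ω6 x y) ∧
      (∀ x y z : V6,
        φ ![P x, P y, P z] = (-(lamH (ap3 φ)) / 4) ^ ((1 : ℝ) / 4) * phi0 x y z) := by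
  obtain ⟨p, hp⟩ := exists_ap3_eq_primForm φ hprim
  rw [hp] at hlam hpos ⊢
  set s := √(-lamH (primForm p))
  have hs₀ : 0 < s := Real.sqrt_pos.2 (neg_pos.2 hlam)
  have hs₂ : s * s = -lamH (primForm p) := Real.mul_self_sqrt (neg_pos.2 hlam).le
  let J : V6 →ₗ[ℝ] V6 := s⁻¹ • Matrix.toLin' (hitchinMatrix p)
  have hJx (x : V6) : J x = s⁻¹ • (hitchinMatrix p).mulVec x := rfl
  have hJ (x : V6) : J (J x) = -x := by
    rw [hJx, hJx, Matrix.mulVec_smul, hitchinMatrix_mulVec_mulVec, smul_smul, smul_smul,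
      ← neg_neg (lamH _), ← hs₂, ← neg_one_smul ℝ x]
    congr 1
    field_simp
  have hω (x y : V6) : ω6 x (J y) = s⁻¹ * ω6 x ((hitchinMatrix p).mulVec y) := by
    rw [hJx, ← symplecticForm_apply, map_smul]
    rfl
  have hJpos (x : V6) (hx : x ≠ 0) : 0 < ω6 x (J x) := by
    have := hpos x hx
    rwa [Jmap, Kmap_primForm] at this
  have hφ (x y z : V6) : ap3 φ x (J y) z = ap3 φ x y (J z) := by
    have h₁ := ap3_sum_mid φ {()} (fun _ => s⁻¹) (fun _ => (hitchinMatrix p).mulVec y) x z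
    have h₂ := ap3_sum_right φ {()} (fun _ => s⁻¹) (fun _ => (hitchinMatrix p).mulVec z) x y
    simp only [Finset.sum_singleton, hp, primForm_hitchinMatrix, ← hJx] at h₁ h₂ ⊢
    rw [h₁, h₂]
  obtain ⟨P, a, ha, hP, hPJ, hPφ⟩ := exists_frameMap_normal_form hJ
    (fun x y => by rw [hω, hω, ω6_hitchinMatrix]) hJpos hφ
  have hsa : s = 2 * a ^ 2 := by
    have h := hω (P (e6 0)) (P (e6 0))
    rw [hp] at hPφ
    rw [hPJ, hP, ω6_hitchinMatrix_of_normal_form hP hPφ, ω6_e6_e6] at h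
    have h₁ : gramMatrix 0 1 = 1 := rfl
    rw [h₁] at h
    field_simp at h
    exact h
  have hM : (-lamH (primForm p) / 4) ^ ((1 : ℝ) / 4) = a := by
    have : -lamH (primForm p) / 4 = a ^ (4 : ℕ) := by rw [← hs₂, hsa]; ring
    rw [this, show (1 : ℝ) / 4 = ((4 : ℕ) : ℝ)⁻¹ by norm_num]
    exact Real.pow_rpow_inv_natCast ha (by norm_num)
  refine ⟨by have := neg_pos.2 hlam; positivity, P, ?_, hP, fun x y z => ?_⟩
  · have hinj := injective_of_ω6_eq hP
    exact ⟨hinj, LinearMap.injective_iff_surjective.1 hinj⟩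
  · rw [hM]
    exact hPφ x y z
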